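/- arXiv:1103.2184 — 5 statements merged into one kernel-verified Lean document; each statement's English description precedes it below -/
import Mathlib

section
/- Every complex eigenvalue λ of the matrix M1 (viewed as a complex 10×10 matrix, or equivalently every root of the characteristic polynomial of M1 in ℂ) satisfies Re(λ) ≤ 0. In particular, the linearization of the CFP model along the V formation has no eigenvalue with positive real part, so the V formation is not exponentially unstable for the CFP model. -/
/-- Linearization of the CFP model along the V formation. -/
noncomputable def M1 : Matrix (Fin 10) (Fin 10) ℝ :=
  !![-1, -(1/2), 1/2, 1/2, 1/2, 0, 0, 0, 0, 0;
    -(1/2), -1, 1/2, 1/2, 0, 1/2, 0, 0, 0, 0;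
    0, 0, -(1/2), 1/2, 1/2, -(1/2), 0, 0, 0, 0;
    0, 0, 1/2, -(1/2), -(1/2), 1/2, 0, 0, 0, 0;
    0, 0, 0, 0, 0, 0, 0, 0, 0, 0;
    0, 0, 0, 0, 0, 0, 0, 0, 0, 0;
    0, 0, 0, 0, 1/2, 1/2, -(1/2), -(1/2), 0, 0;
    0, 0, 0, 0, 1/2, 1/2, 1/2, -(1/2), 0, 0;
    0, 0, 0, 0, 1/2, 0, 1/2, -(1/2), -1, 1/2;
    0, 0, 0, 0, 0, 1/2, -(1/2), 1/2, 1/2, -1]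


/-- Every complex eigenvalue `λ` of `M1` (i.e. every root in `ℂ` of the characteristic
polynomial of `M1`) satisfies `Re λ ≤ 0`: the V formation is not exponentially
unstable for the CFP model. -/
theorem stmt3 (lam : ℂ) (h : (M1.map ((↑) : ℝ → ℂ)).charpoly.IsRoot lam) :
    lam.re ≤ 0 := by
  by_contra hre
  push Not at hre
  have hne : ∀ r : ℝ, 0 ≤ r → lam + (r : ℂ) ≠ 0 := by
    intro r hr h0
    have := congrArg Complex.re h0
    simp at this
    linarith
  have h0 : lam ≠ 0 := by simpa using hne 0 le_rfl
  have h1 : lam + 1 ≠ 0 := by simpa using hne 1 zero_le_one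
  have h12 : 2 * lam + 1 ≠ 0 := by
    intro h
    apply hne (1/2) (by norm_num)
    push_cast
    linear_combination h / 2
  have h32 : 2 * lam + 3 ≠ 0 := by
    intro h
    apply hne (3/2) (by norm_num)
    push_cast
    linear_combination h / 2
  have hq : 2 * lam ^ 2 + 2 * lam + 1 ≠ 0 := by
    intro h
    have hr := congrArg Complex.re h
    have hi := congrArg Complex.im h
    simp [pow_two] at hr hi
    have him : lam.im = 0 := by
      have : lam.im * (2 * lam.re + 1) = 0 := by linarith
      rcases mul_eq_zero.1 this with h | h
      · exact h
      · linarith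
    rw [him] at hr
    nlinarith
  rw [Polynomial.IsRoot, Matrix.eval_charpoly] at h
  obtain ⟨v, hv, hM⟩ := Matrix.exists_mulVec_eq_zero_iff.2 h
  apply hv
  have e : ∀ i, lam * v i = ∑ j, (M1 i j : ℂ) * v j := by
    intro i
    have := congrFun hM i
    rw [Matrix.sub_mulVec] at this
    simp [Matrix.mulVec, dotProduct, Matrix.diagonal_apply] at this
    exact sub_eq_zero.1 this
  have e0 := e 0
  have e1 := e 1
  have e2 := e 2
  have e3 := e 3
  have e4 := e 4
  have e5 := e 5
  have e6 := e 6
  have e7 := e 7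
  have e8 := e 8
  have e9 := e 9
  simp [M1, Fin.sum_univ_succ] at e0 e1 e2 e3 e4 e5 e6 e7 e8 e9
  have z4 : v 4 = 0 := e4.resolve_left h0
  have z5 : v 5 = 0 := e5.resolve_left h0
  simp only [z4, z5] at e0 e1 e2 e3 e6 e7 e8 e9
  have a1 : v 2 + v 3 = 0 := (mul_eq_zero.1
    (show lam * (v 2 + v 3) = 0 by linear_combination e2 + e3)).resolve_left h0
  have a2 : v 2 - v 3 = 0 := (mul_eq_zero.1
    (show (lam + 1) * (v 2 - v 3) = 0 by linear_combination e2 - e3)).resolve_left h1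
  have z2 : v 2 = 0 := by linear_combination (a1 + a2) / 2
  have z3 : v 3 = 0 := by linear_combination (a1 - a2) / 2
  have z7 : v 7 = 0 := (mul_eq_zero.1
    (show (2 * lam ^ 2 + 2 * lam + 1) * v 7 = 0 by
      linear_combination (2 * lam + 1) * e7 + e6)).resolve_left hq
  have z6 : v 6 = 0 := by
    rw [z7] at e7
    linear_combination -2 * e7
  simp only [z2, z3, z6, z7] at e0 e1 e8 e9
  have b1 : v 8 + v 9 = 0 := (mul_eq_zero.1
    (show (2 * lam + 1) * (v 8 + v 9) = 0 by linear_combination 2 * e8 + 2 * e9)).resolve_left h12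
  have b2 : v 8 - v 9 = 0 := (mul_eq_zero.1
    (show (2 * lam + 3) * (v 8 - v 9) = 0 by linear_combination 2 * e8 - 2 * e9)).resolve_left h32
  have c1 : v 0 + v 1 = 0 := (mul_eq_zero.1
    (show (2 * lam + 3) * (v 0 + v 1) = 0 by linear_combination 2 * e0 + 2 * e1)).resolve_left h32
  have c2 : v 0 - v 1 = 0 := (mul_eq_zero.1
    (show (2 * lam + 1) * (v 0 - v 1) = 0 by linear_combination 2 * e0 - 2 * e1)).resolve_left h12
  have z8 : v 8 = 0 := by linear_combination (b1 + b2) / 2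
  have z9 : v 9 = 0 := by linear_combination (b1 - b2) / 2
  have z0 : v 0 = 0 := by linear_combination (c1 + c2) / 2
  have z1 : v 1 = 0 := by linear_combination (c1 - c2) / 2
  funext i
  fin_cases i
  exacts [z0, z1, z2, z3, z4, z5, z6, z7, z8, z9]
end

section
/- The set of complex eigenvalues of the matrix M2 (i.e., the set of roots in ℂ of the characteristic polynomial of M2) is exactly {0, 1, -1}. -/
/-- Linearization of the Cucker–Smale model along the V-formation solution. -/
noncomputable def M2 : Matrix (Fin 20) (Fin 20) ℝ :=
  !![0, 0, 1, 0, 0, 0, 0, 0, 0, 0, 0, 0, 0, 0, 0, 0, 0, 0, 0, 0;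
    0, 0, 0, 1, 0, 0, 0, 0, 0, 0, 0, 0, 0, 0, 0, 0, 0, 0, 0, 0;
    0, 0, -1, 0, 0, 0, 1, 0, 0, 0, 0, 0, 0, 0, 0, 0, 0, 0, 0, 0;
    0, 0, 0, -1, 0, 0, 0, 1, 0, 0, 0, 0, 0, 0, 0, 0, 0, 0, 0, 0;
    0, 0, 0, 0, 0, 0, 1, 0, 0, 0, 0, 0, 0, 0, 0, 0, 0, 0, 0, 0;
    0, 0, 0, 0, 0, 0, 0, 1, 0, 0, 0, 0, 0, 0, 0, 0, 0, 0, 0, 0;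
    0, 0, 0, 0, 0, 0, -1, 0, 0, 0, 1, 0, 0, 0, 0, 0, 0, 0, 0, 0;
    0, 0, 0, 0, 0, 0, 0, -1, 0, 0, 0, 1, 0, 0, 0, 0, 0, 0, 0, 0;
    0, 0, 0, 0, 0, 0, 0, 0, 0, 0, 1, 0, 0, 0, 0, 0, 0, 0, 0, 0;
    0, 0, 0, 0, 0, 0, 0, 0, 0, 0, 0, 1, 0, 0, 0, 0, 0, 0, 0, 0;
    0, 0, 0, 0, 0, 0, 0, 0, 0, 0, 0, 0, 0, 0, 0, 0, 0, 0, 0, 0;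
    0, 0, 0, 0, 0, 0, 0, 0, 0, 0, 0, 0, 0, 0, 0, 0, 0, 0, 0, 0;
    0, 0, 0, 0, 0, 0, 0, 0, 0, 0, 0, 0, 0, 0, 1, 0, 0, 0, 0, 0;
    0, 0, 0, 0, 0, 0, 0, 0, 0, 0, 0, 0, 0, 0, 0, 1, 0, 0, 0, 0;
    0, 0, 0, 0, 0, 0, 0, 0, 0, 0, -1, 0, 0, 0, 1, 0, 0, 0, 0, 0;
    0, 0, 0, 0, 0, 0, 0, 0, 0, 0, 0, -1, 0, 0, 0, 1, 0, 0, 0, 0;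
    0, 0, 0, 0, 0, 0, 0, 0, 0, 0, 0, 0, 0, 0, 0, 0, 0, 0, 1, 0;
    0, 0, 0, 0, 0, 0, 0, 0, 0, 0, 0, 0, 0, 0, 0, 0, 0, 0, 0, 1;
    0, 0, 0, 0, 0, 0, 0, 0, 0, 0, 0, 0, 0, 0, -1, 0, 0, 0, 1, 0;
    0, 0, 0, 0, 0, 0, 0, 0, 0, 0, 0, 0, 0, 0, 0, -1, 0, 0, 0, 1]


lemma M2_mulVec (v : Fin 20 → ℂ) : (M2.map ((↑) : ℝ → ℂ)).mulVec v =
    ![v 2, v 3, -v 2 + v 6, -v 3 + v 7, v 6, v 7, -v 6 + v 10, -v 7 + v 11, v 10, v 11, 0, 0, v 14, v 15, -v 10 + v 14, -v 11 + v 15, v 18, v 19, -v 14 + v 18, -v 15 + v 19] := by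
  funext i
  fin_cases i <;>
  simp [M2, Matrix.mulVec, dotProduct, Fin.sum_univ_succ, Fin.succ] <;> rfl

lemma root_iff (lam : ℂ) : (M2.map ((↑) : ℝ → ℂ)).charpoly.IsRoot lam ↔
    ∃ v : Fin 20 → ℂ, v ≠ 0 ∧ (M2.map ((↑) : ℝ → ℂ)).mulVec v = lam • v := by
  rw [Polynomial.IsRoot.def, Matrix.eval_charpoly, ← Matrix.exists_mulVec_eq_zero_iff]
  refine exists_congr fun v => and_congr_right fun _ => ?_
  rw [Matrix.sub_mulVec, Matrix.scalar_apply, ← Matrix.smul_one_eq_diagonal,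
    Matrix.smul_mulVec, Matrix.one_mulVec, sub_eq_zero, eq_comm]

lemma forward (lam : ℂ) (v : Fin 20 → ℂ) (hl0 : lam ≠ 0) (hl1 : lam - 1 ≠ 0)
    (hlm : lam + 1 ≠ 0) (hv : (M2.map ((↑) : ℝ → ℂ)).mulVec v = lam • v) : v = 0 := by
  rw [M2_mulVec] at hv
  have h0 : v 2 = lam * v 0 := congrFun hv 0
  have h1 : v 3 = lam * v 1 := congrFun hv 1
  have h2 : -v 2 + v 6 = lam * v 2 := congrFun hv 2
  have h3 : -v 3 + v 7 = lam * v 3 := congrFun hv 3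
  have h4 : v 6 = lam * v 4 := congrFun hv 4
  have h5 : v 7 = lam * v 5 := congrFun hv 5
  have h6 : -v 6 + v 10 = lam * v 6 := congrFun hv 6
  have h7 : -v 7 + v 11 = lam * v 7 := congrFun hv 7
  have h8 : v 10 = lam * v 8 := congrFun hv 8
  have h9 : v 11 = lam * v 9 := congrFun hv 9
  have h10 : 0 = lam * v 10 := congrFun hv 10
  have h11 : 0 = lam * v 11 := congrFun hv 11
  have h12 : v 14 = lam * v 12 := congrFun hv 12
  have h13 : v 15 = lam * v 13 := congrFun hv 13
  have h14 : -v 10 + v 14 = lam * v 14 := congrFun hv 14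
  have h15 : -v 11 + v 15 = lam * v 15 := congrFun hv 15
  have h16 : v 18 = lam * v 16 := congrFun hv 16
  have h17 : v 19 = lam * v 17 := congrFun hv 17
  have h18 : -v 14 + v 18 = lam * v 18 := congrFun hv 18
  have h19 : -v 15 + v 19 = lam * v 19 := congrFun hv 19
  have e10 : v 10 = 0 := by
    refine (mul_eq_zero.mp (?_ : lam * v 10 = 0)).resolve_left hl0
    linear_combination -h10
  have e11 : v 11 = 0 := by
    refine (mul_eq_zero.mp (?_ : lam * v 11 = 0)).resolve_left hl0
    linear_combination -h11
  have e6 : v 6 = 0 := by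
    refine (mul_eq_zero.mp (?_ : (lam + 1) * v 6 = 0)).resolve_left hlm
    linear_combination -h6 + e10
  have e7 : v 7 = 0 := by
    refine (mul_eq_zero.mp (?_ : (lam + 1) * v 7 = 0)).resolve_left hlm
    linear_combination -h7 + e11
  have e2 : v 2 = 0 := by
    refine (mul_eq_zero.mp (?_ : (lam + 1) * v 2 = 0)).resolve_left hlm
    linear_combination -h2 + e6
  have e3 : v 3 = 0 := by
    refine (mul_eq_zero.mp (?_ : (lam + 1) * v 3 = 0)).resolve_left hlm
    linear_combination -h3 + e7
  have e14 : v 14 = 0 := by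
    refine (mul_eq_zero.mp (?_ : (lam - 1) * v 14 = 0)).resolve_left hl1
    linear_combination -h14 - e10
  have e15 : v 15 = 0 := by
    refine (mul_eq_zero.mp (?_ : (lam - 1) * v 15 = 0)).resolve_left hl1
    linear_combination -h15 - e11
  have e18 : v 18 = 0 := by
    refine (mul_eq_zero.mp (?_ : (lam - 1) * v 18 = 0)).resolve_left hl1
    linear_combination -h18 - e14
  have e19 : v 19 = 0 := by
    refine (mul_eq_zero.mp (?_ : (lam - 1) * v 19 = 0)).resolve_left hl1
    linear_combination -h19 - e15
  have e0 : v 0 = 0 := by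
    refine (mul_eq_zero.mp (?_ : lam * v 0 = 0)).resolve_left hl0
    linear_combination -h0 + e2
  have e1 : v 1 = 0 := by
    refine (mul_eq_zero.mp (?_ : lam * v 1 = 0)).resolve_left hl0
    linear_combination -h1 + e3
  have e4 : v 4 = 0 := by
    refine (mul_eq_zero.mp (?_ : lam * v 4 = 0)).resolve_left hl0
    linear_combination -h4 + e6
  have e5 : v 5 = 0 := by
    refine (mul_eq_zero.mp (?_ : lam * v 5 = 0)).resolve_left hl0
    linear_combination -h5 + e7
  have e8 : v 8 = 0 := by
    refine (mul_eq_zero.mp (?_ : lam * v 8 = 0)).resolve_left hl0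
    linear_combination -h8 + e10
  have e9 : v 9 = 0 := by
    refine (mul_eq_zero.mp (?_ : lam * v 9 = 0)).resolve_left hl0
    linear_combination -h9 + e11
  have e12 : v 12 = 0 := by
    refine (mul_eq_zero.mp (?_ : lam * v 12 = 0)).resolve_left hl0
    linear_combination -h12 + e14
  have e13 : v 13 = 0 := by
    refine (mul_eq_zero.mp (?_ : lam * v 13 = 0)).resolve_left hl0
    linear_combination -h13 + e15
  have e16 : v 16 = 0 := by
    refine (mul_eq_zero.mp (?_ : lam * v 16 = 0)).resolve_left hl0
    linear_combination -h16 + e18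
  have e17 : v 17 = 0 := by
    refine (mul_eq_zero.mp (?_ : lam * v 17 = 0)).resolve_left hl0
    linear_combination -h17 + e19
  funext i
  fin_cases i <;> assumption

/-- The set of complex eigenvalues of `M2` (roots in `ℂ` of its characteristic
polynomial) is exactly `{0, 1, -1}`. -/
theorem stmt6 :
    {lam : ℂ | (M2.map ((↑) : ℝ → ℂ)).charpoly.IsRoot lam} = {0, 1, -1} := by
  ext lam
  simp only [Set.mem_setOf_eq, Set.mem_insert_iff, Set.mem_singleton_iff]
  rw [root_iff]
  constructor
  · rintro ⟨v, hv0, hv⟩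
    by_contra! h
    exact hv0 (forward lam v h.1 (sub_ne_zero.mpr h.2.1)
      (fun h' => h.2.2 (eq_neg_of_add_eq_zero_left h')) hv)
  · rintro (rfl | rfl | rfl)
    · refine ⟨![1, 0, 0, 0, 0, 0, 0, 0, 0, 0, 0, 0, 0, 0, 0, 0, 0, 0, 0, 0], fun h => by simpa using congrFun h 0, ?_⟩
      rw [M2_mulVec]; funext i; fin_cases i <;> simp
    · refine ⟨![0, 0, 0, 0, 0, 0, 0, 0, 0, 0, 0, 0, 0, 0, 0, 0, 1, 0, 1, 0], fun h => by simpa using congrFun h 16, ?_⟩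
      rw [M2_mulVec]; funext i; fin_cases i <;> simp
    · refine ⟨![-1, 0, 1, 0, 0, 0, 0, 0, 0, 0, 0, 0, 0, 0, 0, 0, 0, 0, 0, 0], fun h => by simpa using congrFun h 0, ?_⟩
      rw [M2_mulVec]; funext i; fin_cases i <;> simp
end

section
/- There exists a nonzero vector y₀ ∈ ℝ²⁰ such that the solution y(t) = exp(t·M2)·y₀ of the linear differential equation y' = M2·y satisfies ‖y(t)‖ = e^t·‖y₀‖ for all t ≥ 0; in particular ‖y(t)‖ → ∞ as t → ∞, so the linearized Cucker–Smale dynamics along the V formation has exponentially growing solutions. -/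
/-- The solution `y(t) = exp (t • M) ⬝ y₀` of `y' = M ⬝ y`, viewed in Euclidean `ℝ²⁰`. -/
noncomputable def sol (M : Matrix (Fin 20) (Fin 20) ℝ) (y₀ : EuclideanSpace ℝ (Fin 20))
    (t : ℝ) : EuclideanSpace ℝ (Fin 20) :=
  (WithLp.equiv 2 (Fin 20 → ℝ)).symm
    ((NormedSpace.exp (t • M)).mulVec ((WithLp.equiv 2 (Fin 20 → ℝ)) y₀))

theorem M2_eig : M2.mulVec (fun i => if i = 16 ∨ i = 18 then 1 else 0) =
    (fun i => if i = 16 ∨ i = 18 then (1 : ℝ) else 0) := by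
  have hv : (fun i : Fin 20 => if i = 16 ∨ i = 18 then (1 : ℝ) else 0) =
      Pi.single 16 1 + Pi.single 18 1 := by
    ext i
    by_cases h1 : i = 16
    · subst h1; simp
    · by_cases h2 : i = 18
      · subst h2; simp
      · simp [h1, h2]
  rw [hv, Matrix.mulVec_add, Matrix.mulVec_single_one, Matrix.mulVec_single_one, ← hv]
  ext i
  have h16 : M2 i 16 = 0 := by fin_cases i <;> rfl
  have h18 : M2 i 18 = if i = 16 ∨ i = 18 then 1 else 0 := by
    fin_cases i
    all_goals first
      | (rw [if_pos (by decide)]; rfl)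
      | (rw [if_neg (by decide)]; rfl)
  simp only [Pi.add_apply, Matrix.col_apply, h16, h18, zero_add]

theorem exp_mulVec_eig (M : Matrix (Fin 20) (Fin 20) ℝ) (v : Fin 20 → ℝ)
    (h : M.mulVec v = v) (t : ℝ) :
    (NormedSpace.exp (t • M)).mulVec v = Real.exp t • v := by
  letI : NormedRing (Matrix (Fin 20) (Fin 20) ℝ) := Matrix.linftyOpNormedRing
  letI : NormedAlgebra ℝ (Matrix (Fin 20) (Fin 20) ℝ) := Matrix.linftyOpNormedAlgebra
  have hp : ∀ n : ℕ, (M ^ n).mulVec v = v := by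
    intro n
    induction n with
    | zero => simp
    | succ k ih => rw [pow_succ, ← Matrix.mulVec_mulVec, h, ih]
  have h1 : HasSum (fun n : ℕ => ((n.factorial : ℝ)⁻¹ • (t • M) ^ n))
      (NormedSpace.exp (t • M)) := NormedSpace.exp_series_hasSum_exp' (𝕂 := ℝ) (t • M)
  have hc : Continuous (fun A : Matrix (Fin 20) (Fin 20) ℝ => A.mulVec v) :=
    continuous_id.matrix_mulVec continuous_const
  have h2 := h1.map (⟨⟨fun A : Matrix (Fin 20) (Fin 20) ℝ => A.mulVec v, Matrix.zero_mulVec v⟩,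
    fun A B => Matrix.add_mulVec A B v⟩ : Matrix (Fin 20) (Fin 20) ℝ →+ (Fin 20 → ℝ)) hc
  have h3 : HasSum (fun n : ℕ => ((n.factorial : ℝ)⁻¹ • t ^ n)) (Real.exp t) := by
    rw [Real.exp_eq_exp_ℝ]
    exact NormedSpace.exp_series_hasSum_exp' (𝕂 := ℝ) t
  have h4 := h3.smul_const v
  refine h2.unique ?_
  convert h4 using 1
  ext n : 1
  simp [smul_pow, Matrix.smul_mulVec, hp, smul_smul]

/-- There is a nonzero initial datum `y₀` whose solution of `y' = M2 ⬝ y` satisfies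
`‖y(t)‖ = eᵗ‖y₀‖` for all `t ≥ 0`; in particular `‖y(t)‖ → ∞` as `t → ∞`, so the
linearized Cucker–Smale dynamics along the V formation has exponentially growing
solutions. -/
theorem stmt8 :
    ∃ y₀ : EuclideanSpace ℝ (Fin 20), y₀ ≠ 0 ∧
      (∀ t : ℝ, 0 ≤ t → ‖sol M2 y₀ t‖ = Real.exp t * ‖y₀‖) ∧
      Filter.Tendsto (fun t : ℝ => ‖sol M2 y₀ t‖) Filter.atTop Filter.atTop := by
  have hs : ∀ t : ℝ, sol M2 (WithLp.toLp 2 (fun i => if i = 16 ∨ i = 18 then (1 : ℝ) else 0)) t =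
      Real.exp t • WithLp.toLp 2 (fun i => if i = 16 ∨ i = 18 then (1 : ℝ) else 0) := by
    intro t
    have := exp_mulVec_eig M2 _ M2_eig t
    simp only [sol, WithLp.equiv_apply, WithLp.equiv_symm_apply]
    rw [this, WithLp.toLp_smul]
  have h0 : (WithLp.toLp 2 (fun i => if i = 16 ∨ i = 18 then (1 : ℝ) else 0) :
      EuclideanSpace ℝ (Fin 20)) ≠ 0 := by
    intro h
    have := congrArg (fun x : EuclideanSpace ℝ (Fin 20) => x 16) h
    simp at this
  have hn : ∀ t : ℝ, ‖sol M2 (WithLp.toLp 2 (fun i => if i = 16 ∨ i = 18 then (1 : ℝ) else 0)) t‖ =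
      Real.exp t * ‖(WithLp.toLp 2 (fun i => if i = 16 ∨ i = 18 then (1 : ℝ) else 0) :
      EuclideanSpace ℝ (Fin 20))‖ := by
    intro t
    rw [hs, norm_smul, Real.norm_of_nonneg (Real.exp_pos t).le]
  refine ⟨_, h0, fun t _ => hn t, ?_⟩
  simp_rw [hn]
  exact Real.tendsto_exp_atTop.atTop_mul_const (norm_pos_iff.mpr h0)
end

section
/- The matrix M3 has a complex eigenvalue λ (a root of its characteristic polynomial in ℂ) with Re(λ) > 0. Hence the V formation is exponentially unstable for the Olfati-Saber model. -/
/-- Linearization of the Olfati-Saber model along the V-formation solution. -/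
noncomputable def M3 : Matrix (Fin 20) (Fin 20) ℝ :=
  !![0, 0, 1, 0, 0, 0, 0, 0, 0, 0, 0, 0, 0, 0, 0, 0, 0, 0, 0, 0;
    0, 0, 0, 1, 0, 0, 0, 0, 0, 0, 0, 0, 0, 0, 0, 0, 0, 0, 0, 0;
    (Real.sqrt 2 - 4), -2, 0, (4 - Real.sqrt 2), -2, 2, 0, 0, 0, 0, 0, 0, 0, 0, 0, 0, 0, 0, 0, 0;
    2, (Real.sqrt 2 - 4), 0, -2, -2, (4 - Real.sqrt 2), 0, 2, 0, 0, 0, 0, 0, 0, 0, 0, 0, 0, 0, 0;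
    0, 0, 0, 0, 0, 0, 1, 0, 0, 0, 0, 0, 0, 0, 0, 0, 0, 0, 0, 0;
    0, 0, 0, 0, 0, 0, 0, 1, 0, 0, 0, 0, 0, 0, 0, 0, 0, 0, 0, 0;
    0, 0, 0, 0, (Real.sqrt 2 - 4), 2, -2, 0, (4 - Real.sqrt 2), -2, 2, 0, 0, 0, 0, 0, 0, 0, 0, 0;
    0, 0, 0, 0, 2, (Real.sqrt 2 - 4), 0, -2, -2, (4 - Real.sqrt 2), 0, 2, 0, 0, 0, 0, 0, 0, 0, 0;
    0, 0, 0, 0, 0, 0, 0, 0, 0, 0, 0, 0, 0, 0, 0, 0, 0, 0, 0, 0;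
    0, 0, 0, 0, 0, 0, 0, 0, 0, 0, 0, 0, 0, 0, 0, 0, 0, 0, 0, 0;
    0, 0, 0, 0, 0, 0, 0, 0, 0, 0, 0, 0, 0, 0, 0, 0, 0, 0, 0, 0;
    0, 0, 0, 0, 0, 0, 0, 0, 0, 0, 0, 0, 0, 0, 0, 0, 0, 0, 0, 0;
    0, 0, 0, 0, 0, 0, 0, 0, 0, 0, 0, 0, 0, 0, 1, 0, 0, 0, 0, 0;
    0, 0, 0, 0, 0, 0, 0, 0, 0, 0, 0, 0, 0, 0, 0, 1, 0, 0, 0, 0;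
    0, 0, 0, 0, 0, 0, 0, 0, (Real.sqrt 2 - 4), 2, -2, 0, (4 - Real.sqrt 2), -2, 2, 0, 0, 0, 0, 0;
    0, 0, 0, 0, 0, 0, 0, 0, 2, (Real.sqrt 2 - 4), 0, -2, -2, (4 - Real.sqrt 2), 0, 2, 0, 0, 0, 0;
    0, 0, 0, 0, 0, 0, 0, 0, 0, 0, 0, 0, 0, 0, 0, 0, 0, 0, 1, 0;
    0, 0, 0, 0, 0, 0, 0, 0, 0, 0, 0, 0, 0, 0, 0, 0, 0, 0, 0, 1;
    0, 0, 0, 0, 0, 0, 0, 0, 0, 0, 0, 0, (Real.sqrt 2 - 4), 2, -2, 0, (4 - Real.sqrt 2), -2, 2, 0;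
    0, 0, 0, 0, 0, 0, 0, 0, 0, 0, 0, 0, 2, (Real.sqrt 2 - 4), 0, -2, -2, (4 - Real.sqrt 2), 0, 2]


/-- `M3` has a complex eigenvalue with positive real part: the V formation is
exponentially unstable for the Olfati-Saber model. -/
theorem stmt11 :
    ∃ lam : ℂ, (M3.map ((↑) : ℝ → ℂ)).charpoly.IsRoot lam ∧ 0 < lam.re := by
  by_contra! h
  have htr : (M3.map ((↑) : ℝ → ℂ)).trace = 2 := by
    simp only [Matrix.trace, Matrix.diag_apply, Matrix.map_apply]
    rw [← Complex.ofReal_sum]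
    have : ∑ i, M3 i i = 2 := by
      simp [Fin.sum_univ_succ, M3]
    rw [this]; norm_num
  have h1 := Matrix.trace_eq_sum_roots_charpoly (M3.map ((↑) : ℝ → ℂ))
  rw [htr] at h1
  have h2 : ∀ m : Multiset ℂ, (∀ x ∈ m, x.re ≤ 0) → m.sum.re ≤ 0 := by
    intro m
    induction m using Multiset.induction_on with
    | empty => simp
    | cons a m ih =>
      intro hm
      rw [Multiset.sum_cons, Complex.add_re]
      have ha := hm a (Multiset.mem_cons_self a m)
      have hb := ih (fun x hx => hm x (Multiset.mem_cons_of_mem hx))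
      linarith
  have h3 := h2 _ (fun x hx => h x (Polynomial.isRoot_of_mem_roots hx))
  rw [← h1] at h3
  norm_num at h3
end

section
/- There exists y₀ ∈ ℝ²⁰ such that the solution y(t) = exp(t·M3)·y₀ of the linear differential equation y' = M3·y is unbounded on [0,∞), i.e. sup_{t ≥ 0} ‖y(t)‖ = ∞ (Euclidean norm). Thus the linearized Olfati-Saber dynamics along the V formation has unbounded solutions. -/
open scoped Matrix.Norms.Operator in
lemma exp_eig (A : Matrix (Fin 20) (Fin 20) ℝ) (v : Fin 20 → ℝ) (l : ℝ)
    (h : A.mulVec v = l • v) : (NormedSpace.exp A).mulVec v = Real.exp l • v := by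
  have hp : ∀ n : ℕ, (A ^ n).mulVec v = l ^ n • v := by
    intro n
    induction n with
    | zero => simp
    | succ k ih => rw [pow_succ, ← Matrix.mulVec_mulVec, h, Matrix.mulVec_smul, ih, smul_smul, pow_succ, mul_comm]
  have h1 := NormedSpace.exp_series_hasSum_exp' (𝕂 := ℝ) A
  let L : Matrix (Fin 20) (Fin 20) ℝ →ₗ[ℝ] (Fin 20 → ℝ) :=
    { toFun := fun B => B.mulVec v
      map_add' := fun B C => Matrix.add_mulVec B C v
      map_smul' := fun c B => Matrix.smul_mulVec c B v }
  have h2 := h1.map L (LinearMap.continuous_of_finiteDimensional L)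
  have h3 := (NormedSpace.exp_series_hasSum_exp' (𝕂 := ℝ) l).smul_const v
  rw [← Real.exp_eq_exp_ℝ] at h3
  refine h2.unique ?_
  convert h3 using 1
  funext n
  change (((n.factorial : ℝ)⁻¹) • A ^ n).mulVec v = _
  rw [Matrix.smul_mulVec, hp, smul_assoc]

lemma M3_eig (l : ℝ) (hl : l * l = 2 * l + (2 - Real.sqrt 2)) :
    M3.mulVec ![0,0,0,0,0,0,0,0,0,0,0,0,0,0,0,0,1,1,l,l]
      = l • ![0,0,0,0,0,0,0,0,0,0,0,0,0,0,0,0,1,1,l,l] := by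
  funext i
  fin_cases i <;> simp [M3, Matrix.mulVec, dotProduct, Fin.sum_univ_succ] <;> linarith

/-- There is an initial datum `y₀` whose solution `y(t) = exp (t • M3) ⬝ y₀` of
`y' = M3 ⬝ y` is unbounded on `[0,∞)`: the linearized Olfati-Saber dynamics along
the V formation has unbounded solutions. -/
theorem stmt13 :
    ∃ y₀ : EuclideanSpace ℝ (Fin 20), ∀ C : ℝ, ∃ t : ℝ, 0 ≤ t ∧ C < ‖sol M3 y₀ t‖ := by
  have h2 : Real.sqrt 2 < 2 := by
    rw [Real.sqrt_lt' (by norm_num)]; norm_num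
  set l : ℝ := 1 + Real.sqrt (3 - Real.sqrt 2) with hl
  have hl1 : 1 ≤ l := by have := Real.sqrt_nonneg (3 - Real.sqrt 2); linarith
  have hll : l * l = 2 * l + (2 - Real.sqrt 2) := by
    have := Real.mul_self_sqrt (show 0 ≤ 3 - Real.sqrt 2 by linarith)
    rw [hl]; linarith
  refine ⟨WithLp.toLp 2 ![0,0,0,0,0,0,0,0,0,0,0,0,0,0,0,0,1,1,l,l], fun C => ⟨|C|, abs_nonneg C, ?_⟩⟩
  have he := exp_eig (|C| • M3) _ (|C| * l) (by
    rw [Matrix.smul_mulVec, M3_eig l hll, smul_smul])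
  have hc := PiLp.norm_apply_le (sol M3 (WithLp.toLp 2 ![0,0,0,0,0,0,0,0,0,0,0,0,0,0,0,0,1,1,l,l]) |C|) 16
  have hv : sol M3 (WithLp.toLp 2 ![0,0,0,0,0,0,0,0,0,0,0,0,0,0,0,0,1,1,l,l]) |C| 16 = Real.exp (|C| * l) := by
    have := congrFun he 16
    refine Eq.trans this ?_
    simp
  rw [hv, Real.norm_eq_abs, abs_of_pos (Real.exp_pos _)] at hc
  have := Real.add_one_le_exp (|C| * l)
  have := le_abs_self C
  nlinarith [abs_nonneg C]
end
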